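/- Let ℱ be a construction scheme, m ≥ 1 and γ < ω₁, and let k be at least ρ^{[γ,γ+m)}, the maximum of ρ(γ+i, γ+j) over i, j < m. Then for every s ≥ k and every i < m: ‖γ+i‖_s = ‖γ‖_s + i. -/

import Mathlib

noncomputable section

open scoped Classical

/-- The first uncountable ordinal. -/
def omegaOne : Ordinal := (Cardinal.aleph 1).ord

/-- A scheme type. -/
structure SchemeType where
  m : ℕ → ℕ
  n : ℕ → ℕ
  r : ℕ → ℕ
  m_zero : m 0 = 1
  n_ge : ∀ k, 2 ≤ n (k + 1)
  r_lt : ∀ k, r (k + 1) < m k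
  m_succ : ∀ k, m (k + 1) = r (k + 1) + (m k - r (k + 1)) * n (k + 1)

/-- `A` is an initial segment of `B`. -/
def InitSeg (A B : Finset Ordinal) : Prop := ∀ a ∈ A, ∀ b ∈ B, b < a → b ∈ A

/-- `D`, `R` form the canonical decomposition of `F ∈ ℱ_{k+1}`. -/
def IsDecomposition (T : SchemeType) (ℱ : Set (Finset Ordinal)) (k : ℕ)
    (F : Finset Ordinal) (D : ℕ → Finset Ordinal) (R : Finset Ordinal) : Prop :=
  (∀ i < T.n (k + 1), D i ∈ ℱ ∧ (D i).card = T.m k) ∧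
  F = (Finset.range (T.n (k + 1))).biUnion D ∧
  R.card = T.r (k + 1) ∧
  (∀ i < T.n (k + 1), ∀ j < T.n (k + 1), i ≠ j → D i ∩ D j = R) ∧
  (∀ i < T.n (k + 1), ∀ x ∈ R, ∀ y ∈ D i \ R, x < y) ∧
  (∀ i j, i < j → j < T.n (k + 1) → ∀ x ∈ D i \ R, ∀ y ∈ D j \ R, x < y)

/-- `ℱ` is a construction scheme of type `T` on `ω₁`. -/
structure IsConstructionScheme (T : SchemeType) (ℱ : Set (Finset Ordinal)) : Prop where
  nonempty_mem : ∀ F ∈ ℱ, F.Nonempty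
  mem_subset : ∀ F ∈ ℱ, ↑F ⊆ Set.Iio omegaOne
  cofinal : ∀ A : Finset Ordinal, ↑A ⊆ Set.Iio omegaOne → ∃ F ∈ ℱ, A ⊆ F
  card_eq : ∀ F ∈ ℱ, ∃ k, F.card = T.m k
  inter_initSeg : ∀ k : ℕ, ∀ E ∈ ℱ, ∀ F ∈ ℱ, E.card = T.m k → F.card = T.m k →
    InitSeg (E ∩ F) E ∧ InitSeg (E ∩ F) F
  decomp : ∀ k : ℕ, ∀ F ∈ ℱ, F.card = T.m (k + 1) → ∃ D R, IsDecomposition T ℱ k F D R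

/-- `ρ(α,β)`: least `k` such that `{α,β}` is included in a member of `ℱ_k`. -/
def rho (T : SchemeType) (ℱ : Set (Finset Ordinal)) (α β : Ordinal) : ℕ :=
  sInf {k | ∃ F ∈ ℱ, F.card = T.m k ∧ α ∈ F ∧ β ∈ F}

/-- `‖α‖_k`, the cardinality of `(α)_k \ {α}`. -/
def nrm (T : SchemeType) (ℱ : Set (Finset Ordinal)) (α : Ordinal) (k : ℕ) : ℕ :=
  Set.ncard {ξ : Ordinal | ξ < α ∧ rho T ℱ α ξ ≤ k}

/-- `Δ(α,β)`: least `k` with `‖α‖_k ≠ ‖β‖_k`. -/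
def deltaOrd (T : SchemeType) (ℱ : Set (Finset Ordinal)) (α β : Ordinal) : ℕ :=
  sInf {k | nrm T ℱ α k ≠ nrm T ℱ β k}

/-- `Ξ_α(k)`. -/
def Xi (T : SchemeType) (ℱ : Set (Finset Ordinal)) (α : Ordinal) (k : ℕ) : ℤ :=
  if k = 0 then 0
  else if h : ∃ i : ℕ, ∃ F ∈ ℱ, ∃ D R, F.card = T.m k ∧ α ∈ F ∧
      IsDecomposition T ℱ (k - 1) F D R ∧ i < T.n k ∧ α ∈ D i ∧ α ∉ R
  then (h.choose : ℤ) else -1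

/-- The `a`-th element of a finite set of ordinals, in increasing order. -/
def elt (A : Finset Ordinal) (a : ℕ) : Ordinal := (A.sort (· ≤ ·)).getD a 0

/-- The family `⟨D_0, …, D_{j-1}⟩` is Δ-captured at level `l`. -/
def DeltaCapturedFam (T : SchemeType) (ℱ : Set (Finset Ordinal)) (j : ℕ)
    (D : ℕ → Finset Ordinal) (l : ℕ) : Prop :=
  ∃ R : Finset Ordinal,
    (∀ i < j, ∀ i' < j, (D i).card = (D i').card) ∧
    (∀ i < j, ∀ i' < j, i ≠ i' → D i ∩ D i' = R) ∧
    (∀ i < j, ∀ x ∈ R, ∀ y ∈ D i \ R, x < y) ∧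
    (∀ i i', i < i' → i' < j → ∀ x ∈ D i \ R, ∀ y ∈ D i' \ R, x < y) ∧
    (∀ i < j, ∀ a < R.card, Xi T ℱ (elt (D i) a) l = -1) ∧
    (∀ i < j, ∀ a, R.card ≤ a → a < (D i).card → Xi T ℱ (elt (D i) a) l = (i : ℤ)) ∧
    (∀ i < j, ∀ i' < j, i ≠ i' → ∀ a, R.card ≤ a → a < (D i).card →
      deltaOrd T ℱ (elt (D i) a) (elt (D i') a) = l)

/-- The family `⟨D_0, …, D_{j-1}⟩` is captured at level `l`. -/
def CapturedFam (T : SchemeType) (ℱ : Set (Finset Ordinal)) (j : ℕ)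
    (D : ℕ → Finset Ordinal) (l : ℕ) : Prop :=
  DeltaCapturedFam T ℱ j D l ∧
  ∀ i < j, ∀ i' < j, i ≠ i' → ∀ a, (D i ∩ D i').card ≤ a → a < (D i).card →
    rho T ℱ (elt (D i) a) (elt (D i') a) = l

/-- The ordered pair `⟨A, B⟩`, as a family. -/
def pairFam (A B : Finset Ordinal) : ℕ → Finset Ordinal := fun i => if i = 0 then A else B

/-- A pair of ordinals `α < β` is captured at level `l`, i.e. `⟨{α},{β}⟩` is. -/
def CapturedPair (T : SchemeType) (ℱ : Set (Finset Ordinal)) (α β : Ordinal) (l : ℕ) : Prop :=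
  α < β ∧ Xi T ℱ α l = 0 ∧ Xi T ℱ β l = 1 ∧ deltaOrd T ℱ α β = l ∧ rho T ℱ α β = l

/-- `ℱ` is a 2-Δ-capturing scheme. -/
def TwoDeltaCapturing (T : SchemeType) (ℱ : Set (Finset Ordinal)) : Prop :=
  ∀ 𝒮 : Set (Finset Ordinal), (∀ A ∈ 𝒮, A.Nonempty ∧ ↑A ⊆ Set.Iio omegaOne) →
    ¬ 𝒮.Countable →
    {l : ℕ | ∃ A ∈ 𝒮, ∃ B ∈ 𝒮, A ≠ B ∧ DeltaCapturedFam T ℱ 2 (pairFam A B) l}.Infinite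

/-- `ℱ` is a 2-capturing scheme. -/
def TwoCapturing (T : SchemeType) (ℱ : Set (Finset Ordinal)) : Prop :=
  ∀ 𝒮 : Set (Finset Ordinal), (∀ A ∈ 𝒮, A.Nonempty ∧ ↑A ⊆ Set.Iio omegaOne) →
    ¬ 𝒮.Countable →
    {l : ℕ | ∃ A ∈ 𝒮, ∃ B ∈ 𝒮, A ≠ B ∧ CapturedFam T ℱ 2 (pairFam A B) l}.Infinite

/-- `ℱ` is a fully Δ-capturing scheme. -/
def FullyDeltaCapturing (T : SchemeType) (ℱ : Set (Finset Ordinal)) : Prop :=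
  ∀ 𝒮 : Set (Finset Ordinal), (∀ A ∈ 𝒮, A.Nonempty ∧ ↑A ⊆ Set.Iio omegaOne) →
    ¬ 𝒮.Countable →
    {l : ℕ | ∃ D : ℕ → Finset Ordinal, (∀ i < T.n l, D i ∈ 𝒮) ∧
      (∀ i < T.n l, ∀ i' < T.n l, i ≠ i' → D i ≠ D i') ∧
      DeltaCapturedFam T ℱ (T.n l) D l}.Infinite

/-- `E` is an `n`-entangled subset of the linear order `X`. -/
def IsNEntangled {X : Type*} [LinearOrder X] (E : Set X) (n : ℕ) : Prop :=
  ¬ E.Countable ∧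
  ∀ τ : Fin n → Fin 2, ∀ 𝒜 : Set (Fin n → X),
    (∀ a ∈ 𝒜, StrictMono a ∧ ∀ i, a i ∈ E) →
    (𝒜.Pairwise fun a b => ∀ i j, a i ≠ b j) →
    ¬ 𝒜.Countable →
    ∃ a ∈ 𝒜, ∃ b ∈ 𝒜, a ≠ b ∧ ∀ i, (a i < b i ↔ τ i = 0)


theorem SchemeType.strictMono_m (T : SchemeType) : StrictMono T.m := by
  refine strictMono_nat_of_lt_succ fun k => ?_
  have h : (T.m k - T.r (k + 1)) * 2 ≤ (T.m k - T.r (k + 1)) * T.n (k + 1) :=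
    Nat.mul_le_mul_left _ (T.n_ge k)
  have := T.r_lt k
  rw [T.m_succ k]
  omega

theorem isSuccLimit_omegaOne : Order.IsSuccLimit omegaOne :=
  Cardinal.isSuccLimit_ord (Cardinal.aleph0_le_aleph 1)

theorem add_natCast_lt_omegaOne {γ : Ordinal} (hγ : γ < omegaOne) (i : ℕ) :
    γ + (i : Ordinal) < omegaOne := by
  induction i with
  | zero => simpa using hγ
  | succ i ih =>
    rw [Nat.cast_succ, ← add_assoc, ← Order.succ_eq_add_one]
    exact isSuccLimit_omegaOne.succ_lt ih

namespace IsConstructionScheme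

variable {T : SchemeType} {ℱ : Set (Finset Ordinal)}

/-- Every point of a member of `ℱ_l` lies in a member of `ℱ_k` included in it, for `k ≤ l`. -/
theorem exists_subset_level (hS : IsConstructionScheme T ℱ) {k l : ℕ} (hkl : k ≤ l)
    {G : Finset Ordinal} (hG : G ∈ ℱ) (hc : G.card = T.m l) {x : Ordinal} (hx : x ∈ G) :
    ∃ E ∈ ℱ, E.card = T.m k ∧ x ∈ E ∧ E ⊆ G := by
  induction l, hkl using Nat.le_induction generalizing G with
  | base => exact ⟨G, hG, hc, hx, subset_rfl⟩
  | succ l _ ih =>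
    obtain ⟨D, R, hD, rfl, -⟩ := hS.decomp l G hG hc
    obtain ⟨i, hi, hxi⟩ := Finset.mem_biUnion.1 hx
    have hin := hD i (Finset.mem_range.1 hi)
    obtain ⟨E, hE, hEc, hxE, hED⟩ := ih hin.1 hin.2 hxi
    exact ⟨E, hE, hEc, hxE, hED.trans (Finset.subset_biUnion_of_mem D hi)⟩

/-- Every member of `ℱ_k` is included in a member of `ℱ_s`, for `k ≤ s`. -/
theorem exists_superset_level (hS : IsConstructionScheme T ℱ) {k s : ℕ} (hks : k ≤ s)
    {E : Finset Ordinal} (hE : E ∈ ℱ) (hc : E.card = T.m k) :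
    ∃ F ∈ ℱ, F.card = T.m s ∧ E ⊆ F := by
  set N : Finset Ordinal := (Finset.range (T.m s)).image fun i : ℕ => (i : Ordinal)
  have hN : N.card = T.m s := by
    rw [Finset.card_image_of_injective _ Nat.cast_injective, Finset.card_range]
  obtain ⟨G, hG, hEG⟩ := hS.cofinal (E ∪ N) <| by
    intro x hx
    rcases Finset.mem_union.1 hx with hx | hx
    · exact hS.mem_subset E hE hx
    · obtain ⟨i, -, rfl⟩ := Finset.mem_image.1 hx
      simpa using add_natCast_lt_omegaOne isSuccLimit_omegaOne.bot_lt i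
  obtain ⟨l, hl⟩ := hS.card_eq G hG
  have hsl : s ≤ l := by
    rw [← T.strictMono_m.le_iff_le, ← hN, ← hl]
    exact Finset.card_le_card (Finset.subset_union_right.trans hEG)
  have hne := hS.nonempty_mem E hE
  obtain ⟨F, hF, hFc, hxF, -⟩ := hS.exists_subset_level hsl hG hl
    (hEG (Finset.mem_union_left _ (E.max'_mem hne)))
  obtain ⟨E', hE', hE'c, hxE', hE'F⟩ := hS.exists_subset_level hks hF hFc hxF
  refine ⟨F, hF, hFc, fun y hy => ?_⟩
  rcases (E.le_max' y hy).eq_or_lt with h | h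
  · rwa [h]
  · exact hE'F (Finset.mem_of_mem_inter_right ((hS.inter_initSeg k E hE E' hE' hc hE'c).1 _
      (Finset.mem_inter.2 ⟨E.max'_mem hne, hxE'⟩) y hy h))

theorem rho_le_iff (hS : IsConstructionScheme T ℱ) {α β : Ordinal} (hα : α < omegaOne)
    (hβ : β < omegaOne) {s : ℕ} :
    rho T ℱ α β ≤ s ↔ ∃ F ∈ ℱ, F.card = T.m s ∧ α ∈ F ∧ β ∈ F := by
  refine ⟨fun h => ?_, fun h => Nat.sInf_le h⟩
  have hne : {k | ∃ F ∈ ℱ, F.card = T.m k ∧ α ∈ F ∧ β ∈ F}.Nonempty := by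
    obtain ⟨G, hG, hsub⟩ := hS.cofinal {α, β} (by simp [Set.insert_subset_iff, hα, hβ])
    obtain ⟨l, hl⟩ := hS.card_eq G hG
    exact ⟨l, G, hG, hl, hsub (by simp), hsub (by simp)⟩
  obtain ⟨E, hE, hc, hαE, hβE⟩ := Nat.sInf_mem hne
  obtain ⟨F, hF, hFc, hEF⟩ := hS.exists_superset_level h hE hc
  exact ⟨F, hF, hFc, hEF hαE, hEF hβE⟩

theorem nrm_eq_card_filter (hS : IsConstructionScheme T ℱ) {s : ℕ} {F : Finset Ordinal}
    (hF : F ∈ ℱ) (hc : F.card = T.m s) {α : Ordinal} (hα : α ∈ F) :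
    nrm T ℱ α s = (F.filter (· < α)).card := by
  have hα₁ : α < omegaOne := hS.mem_subset F hF hα
  rw [nrm, ← Set.ncard_coe_finset]
  congr 1
  ext ξ
  simp only [Set.mem_ofPred_eq, Finset.coe_filter]
  rw [and_comm, and_congr_left_iff]
  intro hξ
  rw [hS.rho_le_iff hα₁ (hξ.trans hα₁)]
  refine ⟨fun ⟨E, hE, hEc, hαE, hξE⟩ => ?_, fun h => ⟨F, hF, hc, hα, h⟩⟩
  exact Finset.mem_of_mem_inter_right ((hS.inter_initSeg s E hE F hF hEc hc).1 α
    (Finset.mem_inter.2 ⟨hαE, hα⟩) ξ hξE hξ)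

theorem nrm_add_one (hS : IsConstructionScheme T ℱ) {α : Ordinal} (hα : α < omegaOne) {s : ℕ}
    (h : rho T ℱ α (α + 1) ≤ s) : nrm T ℱ (α + 1) s = nrm T ℱ α s + 1 := by
  have hα' : α + 1 < omegaOne := by simpa using add_natCast_lt_omegaOne hα 1
  obtain ⟨F, hF, hc, hαF, hαF'⟩ := (hS.rho_le_iff hα hα').1 h
  rw [hS.nrm_eq_card_filter hF hc hαF, hS.nrm_eq_card_filter hF hc hαF',
    ← Finset.card_insert_of_notMem (s := F.filter (· < α)) (a := α) (by simp)]
  congr 1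
  ext ξ
  simp only [Finset.mem_filter, Finset.mem_insert, Order.lt_add_one_iff, le_iff_eq_or_lt]
  grind

end IsConstructionScheme

/-- For a construction scheme `ℱ`, `m ≥ 1`, `γ < ω₁` and `k ≥ ρ^{[γ,γ+m)}`:
for every `s ≥ k` and `i < m`, `‖γ+i‖_s = ‖γ‖_s + i`. -/
theorem stmt15 (T : SchemeType) (ℱ : Set (Finset Ordinal))
    (hS : IsConstructionScheme T ℱ)
    (m : ℕ) (hm : 1 ≤ m) (γ : Ordinal) (hγ : γ < omegaOne) (k : ℕ)
    (hk : ∀ i < m, ∀ j < m, rho T ℱ (γ + (i : Ordinal)) (γ + (j : Ordinal)) ≤ k) :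
    ∀ s, k ≤ s → ∀ i < m,
      nrm T ℱ (γ + (i : Ordinal)) s = nrm T ℱ γ s + i := by
  intro s hs i
  induction i with
  | zero => simp
  | succ i ih =>
    intro hi
    have h := (hk i (by omega) (i + 1) hi).trans hs
    rw [Nat.cast_succ, ← add_assoc] at h ⊢
    rw [hS.nrm_add_one (add_natCast_lt_omegaOne hγ i) h, ih (by omega), add_assoc]

end
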